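/- arXiv:1406.2010 — 2 statements merged into one kernel-verified Lean document; each statement's English description precedes it below -/
import Mathlib

section
/- One-step expected progress of Random Pursuit with exact line search on quadratics: Let n ≥ 1, let μ be the standard Gaussian measure on ℝⁿ (the product of n standard normal distributions N(0,1)), let A be an n×n real symmetric positive definite matrix with smallest eigenvalue λ_min(A), and define f(x) = (1/2)⟨x, A x⟩. For every x ∈ ℝⁿ, ∫ ( f(x) − ⟨u, A x⟩² / (2⟨u, A u⟩) ) dμ(u) ≤ (1 − λ_min(A)/Tr(A)) · f(x), where the ratio in the integrand is defined to be 0 at u = 0. Equivalently, if x₊ denotes the result of an exact line search from x along a standard Gaussian direction u, then E[f(x₊) | x] ≤ (1 − λ_min(A)/Tr(A)) f(x). -/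
open Matrix MeasureTheory ProbabilityTheory

namespace RandomPursuit

variable {ι : Type*} [Fintype ι]

/-- The law of a vector of independent standard normal coordinates. -/
noncomputable abbrev gaussianPi (ι : Type*) [Fintype ι] : Measure (ι → ℝ) :=
  Measure.pi fun _ : ι => gaussianReal 0 1

lemma measurePreserving_comp_perm (σ : Equiv.Perm ι) :
    MeasurePreserving (fun (u : ι → ℝ) i => u (σ i)) (gaussianPi ι) (gaussianPi ι) := by
  have h := measurePreserving_piCongrLeft (fun _ : ι => gaussianReal 0 1) σ.symm
  convert h using 1
  ext u i
  simp [MeasurableEquiv.piCongrLeft, Equiv.piCongrLeft, Equiv.piCongrLeft']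

lemma measurePreserving_update_neg [DecidableEq ι] (i : ι) :
    MeasurePreserving (fun (u : ι → ℝ) j => if j = i then -u j else u j)
      (gaussianPi ι) (gaussianPi ι) := by
  refine measurePreserving_pi _ _ (f := fun j t => if j = i then -t else t) fun j => ?_
  by_cases h : j = i
  · simp only [h, if_true]
    exact ⟨measurable_neg, by simpa using gaussianReal_map_neg (μ := 0) (v := 1)⟩
  · simp only [h, if_false]
    exact MeasurePreserving.id _

lemma measurePreserving_repr (b : OrthonormalBasis ι ℝ (EuclideanSpace ℝ ι)) :
    MeasurePreserving (fun (u : ι → ℝ) i => b.repr (WithLp.toLp 2 u) i)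
      (gaussianPi ι) (gaussianPi ι) := by
  have h1 : MeasurePreserving (WithLp.toLp 2) (gaussianPi ι)
      (stdGaussian (EuclideanSpace ℝ ι)) := ⟨by fun_prop, map_pi_eq_stdGaussian⟩
  have h2 : MeasurePreserving b.repr (stdGaussian (EuclideanSpace ℝ ι))
      (stdGaussian (EuclideanSpace ℝ ι)) := ⟨by fun_prop, stdGaussian_map _⟩
  have h3 : MeasurePreserving (WithLp.ofLp : EuclideanSpace ℝ ι → ι → ℝ)
      (stdGaussian (EuclideanSpace ℝ ι)) (gaussianPi ι) := by
    refine ⟨by fun_prop, ?_⟩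
    rw [← map_pi_eq_stdGaussian, Measure.map_map (by fun_prop) (by fun_prop)]
    exact Measure.map_id
  exact h3.comp (h2.comp h1)

lemma integral_comp_eq {α : Type*} [MeasurableSpace α] {μ : Measure α} {T : α → α}
    (hT : MeasurePreserving T μ μ) {g : α → ℝ} (hg : Measurable g) :
    ∫ u, g (T u) ∂μ = ∫ u, g u ∂μ := by
  conv_rhs => rw [← hT.map_eq]
  exact (integral_map hT.measurable.aemeasurable hg.aestronglyMeasurable).symm

/-- The diagonal quadratic form with coefficients `l`. -/
def diagForm (l u : ι → ℝ) : ℝ := ∑ j, l j * u j ^ 2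

/-- The normalized second moments `E[uᵢ uⱼ / ∑ₖ lₖ uₖ²]`. -/
noncomputable def ratioMoment (l : ι → ℝ) (i j : ι) : ℝ :=
  ∫ u, u i * u j / diagForm l u ∂gaussianPi ι

@[fun_prop]
lemma measurable_diagForm (l : ι → ℝ) : Measurable (diagForm l) := by
  unfold diagForm
  fun_prop

variable {l : ι → ℝ}

lemma diagForm_nonneg (hl : ∀ i, 0 < l i) (u : ι → ℝ) : 0 ≤ diagForm l u :=
  Finset.sum_nonneg fun i _ => mul_nonneg (hl i).le (sq_nonneg _)

lemma mul_sq_le_diagForm (hl : ∀ i, 0 < l i) (u : ι → ℝ) (i : ι) :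
    l i * u i ^ 2 ≤ diagForm l u :=
  Finset.single_le_sum (f := fun j => l j * u j ^ 2)
    (fun j _ => mul_nonneg (hl j).le (sq_nonneg _)) (Finset.mem_univ i)

lemma diagForm_pos (hl : ∀ i, 0 < l i) {u : ι → ℝ} (hu : u ≠ 0) : 0 < diagForm l u := by
  obtain ⟨i, hi⟩ := Function.ne_iff.1 hu
  have : 0 < u i ^ 2 := by
    have : u i ≠ 0 := hi
    positivity
  exact (mul_pos (hl i) this).trans_le (mul_sq_le_diagForm hl u i)

lemma sq_div_diagForm_le (hl : ∀ i, 0 < l i) (u : ι → ℝ) (i : ι) :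
    u i ^ 2 / diagForm l u ≤ (l i)⁻¹ := by
  refine div_le_of_le_mul₀ (diagForm_nonneg hl u) (inv_nonneg.2 (hl i).le) ?_
  rw [inv_mul_eq_div, le_div_iff₀ (hl i), mul_comm]
  exact mul_sq_le_diagForm hl u i

lemma integrable_ratio (hl : ∀ i, 0 < l i) (i j : ι) :
    Integrable (fun u => u i * u j / diagForm l u) (gaussianPi ι) := by
  refine Integrable.of_bound (Measurable.aestronglyMeasurable (by fun_prop)) ((l i)⁻¹ + (l j)⁻¹) (ae_of_all _ fun u => ?_)
  have hq := diagForm_nonneg hl u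
  calc ‖u i * u j / diagForm l u‖ = |u i * u j| / diagForm l u := by
        rw [Real.norm_eq_abs, abs_div, abs_of_nonneg hq]
    _ ≤ (u i ^ 2 + u j ^ 2) / diagForm l u := by
        gcongr
        rw [abs_le]
        constructor <;> nlinarith [sq_nonneg (u i - u j), sq_nonneg (u i + u j)]
    _ ≤ _ := by
        rw [add_div]
        exact add_le_add (sq_div_diagForm_le hl u i) (sq_div_diagForm_le hl u j)

lemma ratioMoment_of_ne {i j : ι} (hij : i ≠ j) : ratioMoment l i j = 0 := by
  classical
  have h := integral_comp_eq (measurePreserving_update_neg i)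
    (g := fun u => u i * u j / diagForm l u) (by fun_prop)
  have hq : ∀ u : ι → ℝ, diagForm l (fun j => if j = i then -u j else u j) = diagForm l u := by
    intro u
    refine Finset.sum_congr rfl fun k _ => ?_
    dsimp only
    split_ifs <;> ring
  simp only [hq, if_true, if_neg hij.symm, neg_mul, neg_div, integral_neg] at h
  unfold ratioMoment
  linarith

lemma integral_sq_sum_div_diagForm (hl : ∀ i, 0 < l i) (c : ι → ℝ) :
    Integrable (fun u => (∑ i, c i * u i) ^ 2 / diagForm l u) (gaussianPi ι) ∧
    ∫ u, (∑ i, c i * u i) ^ 2 / diagForm l u ∂gaussianPi ι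
      = ∑ i, c i ^ 2 * ratioMoment l i i := by
  have h : (fun u : ι → ℝ => (∑ i, c i * u i) ^ 2 / diagForm l u)
      = fun u => ∑ i, ∑ j, (c i * c j) * (u i * u j / diagForm l u) := by
    ext u
    rw [sq, Finset.sum_mul_sum, Finset.sum_div]
    refine Finset.sum_congr rfl fun i _ => ?_
    rw [Finset.sum_div]
    exact Finset.sum_congr rfl fun j _ => by ring
  have hint : ∀ i j, Integrable (fun u => (c i * c j) * (u i * u j / diagForm l u))
      (gaussianPi ι) := fun i j => (integrable_ratio hl i j).const_mul _
  rw [h]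
  refine ⟨integrable_finsetSum _ fun i _ => integrable_finsetSum _ fun j _ => hint i j, ?_⟩
  rw [integral_finsetSum _ fun i _ => integrable_finsetSum _ fun j _ => hint i j]
  refine Finset.sum_congr rfl fun i _ => ?_
  rw [integral_finsetSum _ fun j _ => hint i j, Finset.sum_eq_single i]
  · rw [integral_const_mul, ratioMoment, sq]
  · intro j _ hj
    rw [integral_const_mul, ← ratioMoment, ratioMoment_of_ne hj.symm, mul_zero]
  · simp

lemma diagForm_comp_swap [DecidableEq ι] (i j : ι) (u : ι → ℝ) :
    diagForm l (fun k => u (Equiv.swap i j k))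
      = diagForm l u + (l i - l j) * (u j ^ 2 - u i ^ 2) := by
  rcases eq_or_ne i j with rfl | hij
  · simp
  · have hs : ∀ v : ι → ℝ, diagForm l v
        = l i * v i ^ 2 + (l j * v j ^ 2 + ∑ k ∈ (Finset.univ.erase i).erase j, l k * v k ^ 2) := by
      intro v
      rw [diagForm, ← Finset.add_sum_erase _ _ (Finset.mem_univ i),
        ← Finset.add_sum_erase (Finset.univ.erase i) _
          (Finset.mem_erase.2 ⟨hij.symm, Finset.mem_univ j⟩)]
    have hr : ∑ k ∈ (Finset.univ.erase i).erase j, l k * u (Equiv.swap i j k) ^ 2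
        = ∑ k ∈ (Finset.univ.erase i).erase j, l k * u k ^ 2 := by
      refine Finset.sum_congr rfl fun k hk => ?_
      simp only [Finset.mem_erase] at hk
      rw [Equiv.swap_apply_of_ne_of_ne hk.2.1 hk.1]
    rw [hs, hs u, hr]
    simp only [Equiv.swap_apply_left, Equiv.swap_apply_right]
    ring

lemma ratioMoment_swap [DecidableEq ι] (i j : ι) :
    ratioMoment l i i
      = ∫ u, u j * u j / diagForm l (fun k => u (Equiv.swap i j k)) ∂gaussianPi ι := by
  have h := integral_comp_eq (measurePreserving_comp_perm (Equiv.swap i j))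
    (g := fun u => u i * u i / diagForm l u) (by fun_prop)
  simp only [Equiv.swap_apply_left] at h
  exact h.symm

lemma integrable_ratio_swap [DecidableEq ι] (hl : ∀ i, 0 < l i) (i j : ι) (a : ι) :
    Integrable (fun u => u a * u a / diagForm l (fun k => u (Equiv.swap i j k)))
      (gaussianPi ι) := by
  have h := (measurePreserving_comp_perm (Equiv.swap i j)).integrable_comp_of_integrable
    (integrable_ratio hl (Equiv.swap i j a) (Equiv.swap i j a))
  simpa [Function.comp_def] using h

/-- A smaller coefficient has a larger normalized second moment. -/
lemma ratioMoment_anti (hl : ∀ i, 0 < l i) {i j : ι} (hij : l i ≤ l j) :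
    ratioMoment l j j ≤ ratioMoment l i i := by
  classical
  have h1 := ratioMoment_swap (l := l) i j
  have h2 := ratioMoment_swap (l := l) j i
  have e1 := integrable_ratio hl i i
  have e2 := integrable_ratio hl j j
  have e3 := integrable_ratio_swap hl i j j
  have e4 := integrable_ratio_swap hl i j i
  rw [Equiv.swap_comm] at h2
  have key : ∫ u, (u j * u j / diagForm l u
        + u i * u i / diagForm l (fun k => u (Equiv.swap i j k))) ∂gaussianPi ι
      ≤ ∫ u, (u i * u i / diagForm l u
        + u j * u j / diagForm l (fun k => u (Equiv.swap i j k))) ∂gaussianPi ι := by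
    refine integral_mono (e2.add e4) (e1.add e3) fun u => ?_
    rcases eq_or_ne u 0 with rfl | hu
    · simp
    have hu' : (fun k => u (Equiv.swap i j k)) ≠ 0 := fun h => hu <| by
      ext k
      simpa using congrFun h (Equiv.swap i j k)
    have hS := diagForm_pos hl hu
    have hS' := diagForm_pos hl hu'
    have hd := diagForm_comp_swap (l := l) i j u
    set S := diagForm l u
    set S' := diagForm l (fun k => u (Equiv.swap i j k))
    show u j * u j / S + u i * u i / S' ≤ u i * u i / S + u j * u j / S'
    rw [div_add_div _ _ hS.ne' hS'.ne', div_add_div _ _ hS.ne' hS'.ne']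
    refine div_le_div_of_nonneg_right ?_ (mul_pos hS hS').le
    have : 0 ≤ (l j - l i) * (u j ^ 2 - u i ^ 2) ^ 2 :=
      mul_nonneg (sub_nonneg.2 hij) (sq_nonneg _)
    rw [hd]
    linarith
  rw [integral_add e2 e4, integral_add e1 e3, ← h1, ← h2] at key
  unfold ratioMoment at *
  linarith

/-- A larger coefficient carries a larger share of the quadratic form. -/
lemma mul_ratioMoment_mono (hl : ∀ i, 0 < l i) {i j : ι} (hij : l i ≤ l j) :
    l i * ratioMoment l i i ≤ l j * ratioMoment l j j := by
  classical
  rw [ratioMoment_swap i j, ratioMoment, ← integral_const_mul, ← integral_const_mul]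
  refine integral_mono ((integrable_ratio_swap hl i j j).const_mul _)
    ((integrable_ratio hl j j).const_mul _) fun u => ?_
  rcases eq_or_ne u 0 with rfl | hu
  · simp
  have hu' : (fun k => u (Equiv.swap i j k)) ≠ 0 := fun h => hu <| by
    ext k
    simpa using congrFun h (Equiv.swap i j k)
  have hS := diagForm_pos hl hu
  have hS' := diagForm_pos hl hu'
  have hd := diagForm_comp_swap (l := l) i j u
  have hj := mul_sq_le_diagForm hl u j
  set S := diagForm l u
  set S' := diagForm l (fun k => u (Equiv.swap i j k))
  show l i * (u j * u j / S') ≤ l j * (u j * u j / S)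
  rw [← mul_div_assoc, ← mul_div_assoc, div_le_div_iff₀ hS' hS]
  have key : l i * S ≤ l j * S' := by
    rw [hd]
    have h1 := mul_nonneg (sub_nonneg.2 hij) (sub_nonneg.2 hj)
    have h2 := mul_nonneg (mul_nonneg (sub_nonneg.2 hij) (hl j).le) (sq_nonneg (u i))
    nlinarith
  nlinarith [mul_le_mul_of_nonneg_left key (mul_self_nonneg (u j))]

lemma sum_mul_ratioMoment [Nonempty ι] (hl : ∀ i, 0 < l i) :
    ∑ i, l i * ratioMoment l i i = 1 := by
  have h : ∑ i, l i * ratioMoment l i i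
      = ∫ u, ∑ i, l i * (u i * u i / diagForm l u) ∂gaussianPi ι := by
    rw [integral_finsetSum _ fun i _ => (integrable_ratio hl i i).const_mul _]
    simp_rw [integral_const_mul]
    rfl
  have hae : ∀ᵐ u ∂gaussianPi ι, ∑ i, l i * (u i * u i / diagForm l u) = 1 := by
    have : NullSingletonClass (gaussianReal 0 1) := nullSingletonClass_gaussianReal one_ne_zero
    filter_upwards [(measure_eq_zero_iff_ae_notMem).1
      (measure_singleton (μ := gaussianPi ι) (0 : ι → ℝ))] with u hu
    have hS := diagForm_pos hl (u := u) hu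
    calc ∑ i, l i * (u i * u i / diagForm l u) = diagForm l u / diagForm l u := by
          conv_rhs => rw [diagForm, Finset.sum_div]
          exact Finset.sum_congr rfl fun i _ => by rw [sq, ← mul_div_assoc]; rfl
      _ = 1 := div_self hS.ne'
  rw [h, integral_congr_ae hae]
  simp

lemma iInf_div_sum_le_mul_ratioMoment [Nonempty ι] (hl : ∀ i, 0 < l i) (i : ι) :
    (⨅ j, l j) / ∑ j, l j ≤ l i * ratioMoment l i i := by
  obtain ⟨m, hm⟩ := exists_eq_ciInf_of_finite (f := l)
  have hmin : ∀ j, l m ≤ l j := fun j => hm ▸ ciInf_le (Set.finite_range l).bddBelow j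
  have hsum : 0 < ∑ j, l j := Finset.sum_pos (fun j _ => hl j) Finset.univ_nonempty
  have h1 : 1 ≤ (∑ j, l j) * ratioMoment l m m := by
    rw [← sum_mul_ratioMoment hl, Finset.sum_mul]
    exact Finset.sum_le_sum fun j _ =>
      mul_le_mul_of_nonneg_left (ratioMoment_anti hl (hmin j)) (hl j).le
  rw [← hm]
  refine le_trans ?_ (mul_ratioMoment_mono hl (hmin i))
  rw [div_le_iff₀ hsum]
  nlinarith [hl m]

/-- The quadratic form of a symmetric matrix in the coordinates of an orthonormal eigenbasis. -/
lemma dotProduct_mulVec_eq_sum [DecidableEq ι] {A : Matrix ι ι ℝ} (hA : A.IsHermitian)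
    (u v : ι → ℝ) :
    u ⬝ᵥ A *ᵥ v = ∑ i, hA.eigenvalues i * hA.eigenvectorBasis.repr (WithLp.toLp 2 v) i
      * hA.eigenvectorBasis.repr (WithLp.toLp 2 u) i := by
  have hv : v = ∑ i, hA.eigenvectorBasis.repr (WithLp.toLp 2 v) i
      • (hA.eigenvectorBasis i : ι → ℝ) := by
    have := congrArg (WithLp.ofLp) (hA.eigenvectorBasis.sum_repr (WithLp.toLp 2 v))
    simpa using this.symm
  conv_lhs => rw [hv, mulVec_sum, dotProduct_sum]
  refine Finset.sum_congr rfl fun i _ => ?_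
  rw [mulVec_smul, hA.mulVec_eigenvectorBasis, dotProduct_smul, dotProduct_smul,
    hA.eigenvectorBasis.repr_apply_apply (WithLp.toLp 2 u), EuclideanSpace.inner_eq_star_dotProduct]
  simp
  ring

end RandomPursuit

open RandomPursuit in
/-- One-step expected progress of Random Pursuit with exact line search on the
quadratic `f(x) = (1/2)⟨x, A x⟩`: for `u` drawn from the standard Gaussian measure
on `ℝⁿ`, the expected value after an exact line search from `x` along `u` satisfies
`E[f(x₊)] ≤ (1 − λ_min(A)/Tr(A)) f(x)`, where `λ_min(A)` is the smallest eigenvalue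
of the symmetric positive definite matrix `A` and the ratio in the integrand is set
to `0` at `u = 0`. -/
theorem random_pursuit_one_step_progress
    (n : ℕ) (hn : 1 ≤ n)
    (μ : Measure (Fin n → ℝ))
    (hμ : μ = Measure.pi fun _ : Fin n => gaussianReal 0 1)
    (A : Matrix (Fin n) (Fin n) ℝ)
    (hA : A.IsHermitian)
    (hpos : ∀ v : Fin n → ℝ, v ≠ 0 → 0 < v ⬝ᵥ A *ᵥ v)
    (f : (Fin n → ℝ) → ℝ)
    (hf : ∀ x : Fin n → ℝ, f x = (1 / 2) * (x ⬝ᵥ A *ᵥ x))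
    (x : Fin n → ℝ) :
    ∫ u, (f x - if u = 0 then 0 else (u ⬝ᵥ A *ᵥ x) ^ 2 / (2 * (u ⬝ᵥ A *ᵥ u))) ∂μ
      ≤ (1 - (⨅ i, hA.eigenvalues i) / A.trace) * f x := by
  subst hμ
  have : Nonempty (Fin n) := ⟨⟨0, hn⟩⟩
  have hl : ∀ i, 0 < hA.eigenvalues i := fun i =>
    (PosDef.of_dotProduct_mulVec_pos hA fun v hv => by simpa using hpos v hv).eigenvalues_pos i
  have htr : A.trace = ∑ i, hA.eigenvalues i := by simpa using hA.trace_eq_sum_eigenvalues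
  set l := hA.eigenvalues
  set y : Fin n → ℝ := fun i => hA.eigenvectorBasis.repr (WithLp.toLp 2 x) i
  obtain ⟨hint, hval⟩ := integral_sq_sum_div_diagForm hl fun i => l i * y i
  have hrot := measurePreserving_repr hA.eigenvectorBasis
  have hfx : f x = (1 / 2) * ∑ i, l i * y i ^ 2 := by
    rw [hf, dotProduct_mulVec_eq_sum hA]
    congr 1
    exact Finset.sum_congr rfl fun i _ => by ring
  have hcongr : ∀ u : Fin n → ℝ,
      (f x - if u = 0 then 0 else (u ⬝ᵥ A *ᵥ x) ^ 2 / (2 * (u ⬝ᵥ A *ᵥ u)))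
        = (fun w : Fin n → ℝ => f x - (1 / 2) * ((∑ i, l i * y i * w i) ^ 2 / diagForm l w))
          fun i => hA.eigenvectorBasis.repr (WithLp.toLp 2 u) i := by
    intro u
    have hq : u ⬝ᵥ A *ᵥ u
        = diagForm l fun i => hA.eigenvectorBasis.repr (WithLp.toLp 2 u) i := by
      rw [dotProduct_mulVec_eq_sum hA, diagForm]
      exact Finset.sum_congr rfl fun i _ => by ring
    have hif : (if u = 0 then 0 else (u ⬝ᵥ A *ᵥ x) ^ 2 / (2 * (u ⬝ᵥ A *ᵥ u)))
        = (u ⬝ᵥ A *ᵥ x) ^ 2 / (2 * (u ⬝ᵥ A *ᵥ u)) := by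
      split_ifs with h
      · simp [h]
      · rfl
    simp only [hif, ← hq]
    rw [dotProduct_mulVec_eq_sum hA u x]
    congr 1
    rw [mul_comm (2 : ℝ), ← div_div]
    ring
  have hmean := (integral_congr_ae (ae_of_all (gaussianPi (Fin n)) hcongr)).trans
    (integral_comp_eq hrot (g := fun w : Fin n → ℝ =>
      f x - (1 / 2) * ((∑ i, l i * y i * w i) ^ 2 / diagForm l w)) (by fun_prop))
  refine hmean.trans_le ?_
  rw [integral_sub (integrable_const _) (hint.const_mul _),
    integral_const_mul, hval, htr]
  have hsum : (⨅ i, l i) / (∑ i, l i) * ∑ i, l i * y i ^ 2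
      ≤ ∑ i, (l i * y i) ^ 2 * ratioMoment l i i := by
    rw [Finset.mul_sum]
    refine Finset.sum_le_sum fun i _ => ?_
    have h := mul_le_mul_of_nonneg_right (iInf_div_sum_le_mul_ratioMoment hl i)
      (mul_nonneg (hl i).le (sq_nonneg (y i)))
    linarith
  simp only [integral_const, probReal_univ, one_smul]
  rw [sub_mul, one_mul, hfx]
  linarith
end

section
/- Linear convergence of Random Pursuit with exact line search on quadratics: Let n ≥ 1, let μ be the standard Gaussian measure on ℝⁿ, let A be an n×n real symmetric positive definite matrix with smallest eigenvalue λ_min(A), and define f(x) = (1/2)⟨x, A x⟩. Define the exact line-search step map T : ℝⁿ × ℝⁿ → ℝⁿ by T(x, u) = x − (⟨u, A x⟩/⟨u, A u⟩) u if ⟨u, A u⟩ ≠ 0 and T(x, u) = x otherwise. Fix x₀ ∈ ℝⁿ and N ≥ 1, and for a tuple (u₁, …, u_N) ∈ (ℝⁿ)^N define recursively x_k = T(x_{k−1}, u_k) for k = 1, …, N. Then, integrating over (u₁, …, u_N) drawn from the N-fold product measure μ^{⊗N}, one has ∫ f(x_N) dμ^{⊗N} ≤ (1 − λ_min(A)/Tr(A))^N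 · f(x₀). -/
open Matrix MeasureTheory ProbabilityTheory

/-- The state reached after `k` steps of the dynamics `T`, driven by the inputs `U`. -/
def drivenIterate {E F : Type*} (T : E → F → E) (x₀ : E) : (k : ℕ) → (Fin k → F) → E
  | 0, _ => x₀
  | k + 1, U => T (drivenIterate T x₀ k fun i => U i.castSucc) (U (Fin.last k))

lemma eq_drivenIterate {E F : Type*} (T : E → F → E) (x₀ : E) {N : ℕ} (U : Fin N → F)
    (X : ℕ → E) (h0 : X 0 = x₀) (hs : ∀ k : Fin N, X (k + 1) = T (X k) (U k)) :
    X N = drivenIterate T x₀ N U := by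
  have key : ∀ k (hk : k ≤ N), X k = drivenIterate T x₀ k fun i => U (i.castLE hk) := by
    intro k
    induction k with
    | zero => intro _; exact h0
    | succ k ih =>
      intro hk
      rw [hs ⟨k, hk⟩, ih (Nat.le_of_succ_le hk)]
      rfl
  exact key N le_rfl

lemma apply_drivenIterate_le {E F : Type*} {T : E → F → E} {f : E → ℝ}
    (hle : ∀ x u, f (T x u) ≤ f x) (x₀ : E) (k : ℕ) (U : Fin k → F) :
    f (drivenIterate T x₀ k U) ≤ f x₀ := by
  induction k with
  | zero => exact le_rfl
  | succ k ih => exact (hle _ _).trans (ih _)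

section Driven

variable {E F : Type*} [MeasurableSpace E] [MeasurableSpace F] {T : E → F → E} {f : E → ℝ}

lemma measurable_drivenIterate (hT : Measurable fun p : E × F => T p.1 p.2) (x₀ : E) (k : ℕ) :
    Measurable (drivenIterate T x₀ k) := by
  induction k with
  | zero => exact measurable_const
  | succ k ih =>
    exact hT.comp ((ih.comp (measurable_pi_lambda _ fun i => measurable_pi_apply _)).prodMk
      (measurable_pi_apply _))

/-- If `f` does not increase along `T` and contracts by `c` on average, then it contracts
geometrically along independent inputs. -/
theorem integral_drivenIterate_le (μ : Measure F) [IsProbabilityMeasure μ]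
    (hT : Measurable fun p : E × F => T p.1 p.2) (hf : Measurable f) (hf0 : ∀ x, 0 ≤ f x)
    (hle : ∀ x u, f (T x u) ≤ f x) {c : ℝ} (hc : 0 ≤ c)
    (hcontr : ∀ x, ∫ u, f (T x u) ∂μ ≤ c * f x) (x₀ : E) (k : ℕ) :
    ∫ U, f (drivenIterate T x₀ k U) ∂(Measure.pi fun _ : Fin k => μ) ≤ c ^ k * f x₀ := by
  have hint : ∀ j, Integrable (fun U => f (drivenIterate T x₀ j U))
      (Measure.pi fun _ : Fin j => μ) := fun j =>
    Integrable.of_bound (hf.comp (measurable_drivenIterate hT x₀ j)).aestronglyMeasurable (f x₀)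
      (ae_of_all _ fun U => by
        rw [Real.norm_of_nonneg (hf0 _)]
        exact apply_drivenIterate_le hle x₀ j U)
  induction k with
  | zero => simp [drivenIterate]
  | succ k ih =>
    have hmp := measurePreserving_piFinSuccAbove (fun _ : Fin (k + 1) => μ) (Fin.last k)
    have hstep : ∀ U, f (drivenIterate T x₀ (k + 1) U) =
        (fun p : F × (Fin k → F) => f (T (drivenIterate T x₀ k p.2) p.1))
          (MeasurableEquiv.piFinSuccAbove (fun _ => F) (Fin.last k) U) := by
      intro U
      simp [drivenIterate, MeasurableEquiv.piFinSuccAbove, Fin.init_def]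
    have hmeas : Measurable fun p : F × (Fin k → F) => f (T (drivenIterate T x₀ k p.2) p.1) :=
      hf.comp (hT.comp (((measurable_drivenIterate hT x₀ k).comp measurable_snd).prodMk
        measurable_fst))
    have hint2 : Integrable (fun p : F × (Fin k → F) => f (T (drivenIterate T x₀ k p.2) p.1))
        (μ.prod (Measure.pi fun _ : Fin k => μ)) :=
      Integrable.of_bound hmeas.aestronglyMeasurable (f x₀) (ae_of_all _ fun p => by
        rw [Real.norm_of_nonneg (hf0 _)]
        exact (hle _ _).trans (apply_drivenIterate_le hle x₀ k _))
    calc ∫ U, f (drivenIterate T x₀ (k + 1) U) ∂(Measure.pi fun _ : Fin (k + 1) => μ)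
        = ∫ p, f (T (drivenIterate T x₀ k p.2) p.1) ∂(μ.prod (Measure.pi fun _ : Fin k => μ)) := by
          simp_rw [hstep]
          exact hmp.integral_comp'
            (fun p : F × (Fin k → F) => f (T (drivenIterate T x₀ k p.2) p.1))
      _ = ∫ U, ∫ u, f (T (drivenIterate T x₀ k U) u) ∂μ ∂(Measure.pi fun _ : Fin k => μ) :=
          integral_prod_symm
            (fun p : F × (Fin k → F) => f (T (drivenIterate T x₀ k p.2) p.1)) hint2
      _ ≤ ∫ U, c * f (drivenIterate T x₀ k U) ∂(Measure.pi fun _ : Fin k => μ) :=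
          integral_mono (f := fun U => ∫ u, f (T (drivenIterate T x₀ k U) u) ∂μ)
            hint2.integral_prod_right ((hint k).const_mul c) fun U => hcontr _
      _ ≤ c ^ (k + 1) * f x₀ := by
          rw [integral_const_mul, pow_succ', mul_assoc]
          exact mul_le_mul_of_nonneg_left ih hc

end Driven

section Gaussian

variable {ι : Type*} [Fintype ι]

lemma measurePreserving_gaussian_orthonormalBasis
    (b : OrthonormalBasis ι ℝ (EuclideanSpace ℝ ι)) :
    MeasurePreserving (fun v : ι → ℝ => WithLp.ofLp (∑ i, v i • b i))
      (Measure.pi fun _ => gaussianReal 0 1) (Measure.pi fun _ => gaussianReal 0 1) := by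
  have hm : Measurable fun v : ι → ℝ => ∑ i, v i • b i := by fun_prop
  have hofLp : Measurable (WithLp.ofLp : EuclideanSpace ℝ ι → ι → ℝ) := by fun_prop
  refine ⟨hofLp.comp hm, ?_⟩
  change Measure.map (WithLp.ofLp ∘ fun v : ι → ℝ => ∑ i, v i • b i) _ = _
  rw [← Measure.map_map hofLp hm, ← stdGaussian_eq_map_pi_orthonormalBasis b,
    ← map_pi_eq_stdGaussian, Measure.map_map hofLp (by fun_prop)]
  exact Measure.map_id

variable [DecidableEq ι]

lemma measurePreserving_gaussian_negAt (i : ι) :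
    MeasurePreserving (fun (v : ι → ℝ) k => if k = i then -v k else v k)
      (Measure.pi fun _ => gaussianReal 0 1) (Measure.pi fun _ => gaussianReal 0 1) := by
  refine measurePreserving_pi (fun _ => gaussianReal 0 1) (fun _ => gaussianReal 0 1)
    (f := fun k t => if k = i then -t else t) fun k => ?_
  by_cases h : k = i
  · simp only [h, if_true]
    exact ⟨measurable_neg, by simpa using gaussianReal_map_neg (μ := 0) (v := 1)⟩
  · simp only [h, if_false]
    exact MeasurePreserving.id _

lemma measurePreserving_pi_swap {α : Type*} [MeasurableSpace α] (ν : Measure α) [SigmaFinite ν]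
    (i j : ι) :
    MeasurePreserving (fun (v : ι → α) k => v (Equiv.swap i j k))
      (Measure.pi fun _ => ν) (Measure.pi fun _ => ν) := by
  have h := measurePreserving_piCongrLeft (α := fun _ : ι => α) (fun _ => ν) (Equiv.swap i j)
  convert h using 1
  funext v k
  have hk := Equiv.piCongrLeft_apply_apply (fun _ : ι => α) (Equiv.swap i j) v (Equiv.swap i j k)
  rw [← Equiv.Perm.mul_apply, Equiv.swap_mul_self, Equiv.Perm.one_apply] at hk
  exact hk.symm

end Gaussian

section Diagonal

variable {ι : Type*} [Fintype ι] {d : ι → ℝ} {m : ℝ}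

lemma mul_sq_le_sum_mul_sq (hd : ∀ i, 0 ≤ d i) (v : ι → ℝ) (i : ι) :
    d i * v i ^ 2 ≤ ∑ k, d k * v k ^ 2 :=
  Finset.single_le_sum (f := fun k => d k * v k ^ 2)
    (fun k _ => mul_nonneg (hd k) (sq_nonneg _)) (Finset.mem_univ i)

lemma sum_mul_sq_pos (hd : ∀ i, 0 < d i) {v : ι → ℝ} (hv : v ≠ 0) :
    0 < ∑ k, d k * v k ^ 2 := by
  obtain ⟨i, hi⟩ := Function.ne_iff.mp hv
  exact (mul_pos (hd i) (sq_pos_of_ne_zero hi)).trans_le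
    (mul_sq_le_sum_mul_sq (fun k => (hd k).le) v i)

lemma abs_mul_div_sum_le (hm : 0 < m) (hmd : ∀ i, m ≤ d i) (v : ι → ℝ) (i j : ι) :
    |v i * v j / ∑ k, d k * v k ^ 2| ≤ m⁻¹ := by
  have hd : ∀ i, 0 < d i := fun i => hm.trans_le (hmd i)
  by_cases hv : v = 0
  · simp [hv, hm.le]
  have hS := sum_mul_sq_pos hd hv
  have hi := mul_sq_le_sum_mul_sq (fun k => (hd k).le) v i
  have hj := mul_sq_le_sum_mul_sq (fun k => (hd k).le) v j
  have hi' := mul_le_mul_of_nonneg_right (hmd i) (sq_nonneg (v i))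
  have hj' := mul_le_mul_of_nonneg_right (hmd j) (sq_nonneg (v j))
  have hab : m * |v i * v j| ≤ ∑ k, d k * v k ^ 2 := by
    rw [abs_mul]
    nlinarith [mul_nonneg hm.le (sq_nonneg (|v i| - |v j|)), sq_abs (v i), sq_abs (v j)]
  rw [abs_div, abs_of_pos hS, div_le_iff₀ hS, inv_mul_eq_div, le_div_iff₀ hm]
  linarith

lemma integrable_mul_div_sum (ν : Measure (ι → ℝ)) [IsFiniteMeasure ν]
    (hm : 0 < m) (hmd : ∀ i, m ≤ d i) (i j : ι) :
    Integrable (fun v : ι → ℝ => v i * v j / ∑ k, d k * v k ^ 2) ν :=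
  Integrable.of_bound (Measurable.aestronglyMeasurable (by fun_prop)) m⁻¹
    (ae_of_all _ fun v => abs_mul_div_sum_le hm hmd v i j)

lemma sum_mul_sq_swap_sub [DecidableEq ι] (d v : ι → ℝ) (i j : ι) :
    ∑ k, d k * v (Equiv.swap i j k) ^ 2 =
      ∑ k, d k * v k ^ 2 + (d j - d i) * (v i ^ 2 - v j ^ 2) := by
  by_cases hij : i = j
  · simp [hij]
  rw [← sub_eq_iff_eq_add', ← Finset.sum_sub_distrib, Fintype.sum_eq_add i j hij]
  · simp only [Equiv.swap_apply_left, Equiv.swap_apply_right]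
    ring
  · rintro k ⟨hki, hkj⟩
    simp [Equiv.swap_apply_of_ne_of_ne hki hkj]

/-- The Gaussian average of `v i * v j / ∑ k, d k * v k ^ 2`. -/
noncomputable def gaussianRatio (d : ι → ℝ) (i j : ι) : ℝ :=
  ∫ v : ι → ℝ, v i * v j / ∑ k, d k * v k ^ 2 ∂(Measure.pi fun _ => gaussianReal 0 1)

lemma gaussianRatio_eq_zero (d : ι → ℝ) {i j : ι} (hij : i ≠ j) : gaussianRatio d i j = 0 := by
  classical
  have hmp := measurePreserving_gaussian_negAt i
  have h : gaussianRatio d i j = -gaussianRatio d i j := by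
    conv_lhs => rw [gaussianRatio, ← hmp.map_eq]
    rw [integral_map hmp.aemeasurable (Measurable.aestronglyMeasurable (by fun_prop)),
      gaussianRatio, ← integral_neg]
    congr 1
    funext v
    have : ∀ k, (if k = i then -v k else v k) ^ 2 = v k ^ 2 := fun k => by split_ifs <;> ring
    simp only [this, if_true, if_neg hij.symm]
    ring
  linarith

lemma gaussianRatio_swap [DecidableEq ι] (d : ι → ℝ) (i j : ι) :
    gaussianRatio d j j = ∫ v : ι → ℝ,
      v i * v i / ∑ k, d k * v (Equiv.swap i j k) ^ 2 ∂(Measure.pi fun _ => gaussianReal 0 1) := by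
  have hmp := measurePreserving_pi_swap (gaussianReal 0 1) i j
  conv_lhs => rw [gaussianRatio, ← hmp.map_eq]
  rw [integral_map hmp.aemeasurable (Measurable.aestronglyMeasurable (by fun_prop))]
  simp

lemma integrable_mul_div_sum_swap [DecidableEq ι] (hm : 0 < m) (hmd : ∀ i, m ≤ d i) (i j l : ι) :
    Integrable (fun v : ι → ℝ => v l * v l / ∑ k, d k * v (Equiv.swap i j k) ^ 2)
      (Measure.pi fun _ => gaussianReal 0 1) := by
  have hmp := measurePreserving_pi_swap (gaussianReal 0 1) i j
  have := hmp.integrable_comp_of_integrable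
    (integrable_mul_div_sum (Measure.pi fun _ => gaussianReal 0 1) hm hmd
      (Equiv.swap i j l) (Equiv.swap i j l))
  simpa [Function.comp_def] using this

lemma gaussianRatio_anti (hm : 0 < m) (hmd : ∀ i, m ≤ d i) {i j : ι} (hij : d i ≤ d j) :
    gaussianRatio d j j ≤ gaussianRatio d i i := by
  classical
  have hd : ∀ i, 0 < d i := fun i => hm.trans_le (hmd i)
  let γ : Measure (ι → ℝ) := Measure.pi fun _ => gaussianReal 0 1
  have hI := fun l => integrable_mul_div_sum γ hm hmd l l
  have hI' := fun l => integrable_mul_div_sum_swap hm hmd i j l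
  have h1 := gaussianRatio_swap d i j
  have h2 := gaussianRatio_swap d j i
  rw [Equiv.swap_comm] at h2
  have hle : ∫ v, (v j * v j / ∑ k, d k * v k ^ 2 +
        v i * v i / ∑ k, d k * v (Equiv.swap i j k) ^ 2) ∂γ ≤
      ∫ v, (v i * v i / ∑ k, d k * v k ^ 2 +
        v j * v j / ∑ k, d k * v (Equiv.swap i j k) ^ 2) ∂γ := by
    refine integral_mono ((hI j).add (hI' i)) ((hI i).add (hI' j)) fun v => ?_
    by_cases hv : v = 0
    · simp [hv]
    have hS := sum_mul_sq_pos hd hv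
    have hS' : 0 < ∑ k, d k * v (Equiv.swap i j k) ^ 2 :=
      sum_mul_sq_pos hd (v := fun k => v (Equiv.swap i j k)) fun h => hv <| by
        funext k
        simpa using congrFun h (Equiv.swap i j k)
    have hsub := sum_mul_sq_swap_sub d v i j
    set S := ∑ k, d k * v k ^ 2
    set S' := ∑ k, d k * v (Equiv.swap i j k) ^ 2
    rw [← sub_nonneg]
    have : v i * v i / S + v j * v j / S' - (v j * v j / S + v i * v i / S') =
        (d j - d i) * (v i ^ 2 - v j ^ 2) ^ 2 / (S * S') := by
      rw [← sub_eq_iff_eq_add'] at hsub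
      rw [sq (v i ^ 2 - v j ^ 2), ← mul_assoc, ← hsub]
      field_simp
      ring
    change 0 ≤ v i * v i / S + v j * v j / S' - (v j * v j / S + v i * v i / S')
    rw [this]
    exact div_nonneg (mul_nonneg (sub_nonneg.2 hij) (sq_nonneg _)) (mul_pos hS hS').le
  rw [integral_add (hI j) (hI' i), integral_add (hI i) (hI' j), ← h1, ← h2] at hle
  change gaussianRatio d j j + _ ≤ gaussianRatio d i i + _ at hle
  linarith

lemma mul_gaussianRatio_mono (hm : 0 < m) (hmd : ∀ i, m ≤ d i) {i j : ι} (hij : d j ≤ d i) :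
    d j * gaussianRatio d j j ≤ d i * gaussianRatio d i i := by
  classical
  have hd : ∀ i, 0 < d i := fun i => hm.trans_le (hmd i)
  rw [gaussianRatio_swap d i j, gaussianRatio, ← integral_const_mul, ← integral_const_mul]
  refine integral_mono ((integrable_mul_div_sum_swap hm hmd i j i).const_mul _)
    ((integrable_mul_div_sum _ hm hmd i i).const_mul _) fun v => ?_
  by_cases hv : v = 0
  · simp [hv]
  have hS := sum_mul_sq_pos hd hv
  have hS' : 0 < ∑ k, d k * v (Equiv.swap i j k) ^ 2 :=
    sum_mul_sq_pos hd (v := fun k => v (Equiv.swap i j k)) fun h => hv <| by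
      funext k
      simpa using congrFun h (Equiv.swap i j k)
  have hsub := sum_mul_sq_swap_sub d v i j
  have hi := mul_sq_le_sum_mul_sq (fun k => (hd k).le) v i
  dsimp only
  set S := ∑ k, d k * v k ^ 2
  set S' := ∑ k, d k * v (Equiv.swap i j k) ^ 2
  have hSS : d j * S ≤ d i * S' := by
    rw [hsub]
    nlinarith [mul_nonneg (sub_nonneg.2 hij)
      (add_nonneg (sub_nonneg.2 hi) (mul_nonneg (hd i).le (sq_nonneg (v j))))]
  rw [← mul_div_assoc, ← mul_div_assoc, div_le_div_iff₀ hS' hS]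
  nlinarith [mul_le_mul_of_nonneg_right hSS (mul_self_nonneg (v i))]

lemma sum_mul_gaussianRatio [Nonempty ι] (hm : 0 < m) (hmd : ∀ i, m ≤ d i) :
    ∑ j, d j * gaussianRatio d j j = 1 := by
  have hd : ∀ i, 0 < d i := fun i => hm.trans_le (hmd i)
  simp_rw [gaussianRatio, ← integral_const_mul]
  rw [← integral_finsetSum _ fun j _ => (integrable_mul_div_sum _ hm hmd j j).const_mul _]
  have : NullSingletonClass (gaussianReal 0 1) := nullSingletonClass_gaussianReal one_ne_zero
  have hae : ∀ᵐ v : ι → ℝ ∂(Measure.pi fun _ => gaussianReal 0 1), v ≠ 0 := by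
    have : NullSingletonClass (Measure.pi fun _ : ι => gaussianReal 0 1) :=
      Measure.pi_nullSingletonClass (Classical.arbitrary ι)
    exact Measure.ae_ne _ _
  rw [integral_congr_ae (g := fun _ => (1 : ℝ))]
  · simp
  · filter_upwards [hae] with v hv
    simp_rw [← mul_div_assoc, ← Finset.sum_div, ← sq]
    exact div_self (sum_mul_sq_pos hd hv).ne'

lemma le_mul_gaussianRatio [Nonempty ι] (hm : 0 < m) (hmd : ∀ i, m ≤ d i) (i : ι) :
    m / ∑ j, d j ≤ d i * gaussianRatio d i i := by
  have hd : ∀ i, 0 < d i := fun i => hm.trans_le (hmd i)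
  have h0 : ∀ j, 0 ≤ gaussianRatio d j j := fun j =>
    integral_nonneg fun v => div_nonneg (mul_self_nonneg _)
      (Finset.sum_nonneg fun k _ => mul_nonneg (hd k).le (sq_nonneg _))
  have key : ∀ j, m * gaussianRatio d j j ≤ d i * gaussianRatio d i i := by
    intro j
    rcases le_total (d i) (d j) with h | h
    · exact mul_le_mul (hmd i) (gaussianRatio_anti hm hmd h) (h0 j) (hd i).le
    · exact (mul_le_mul_of_nonneg_right (hmd j) (h0 j)).trans (mul_gaussianRatio_mono hm hmd h)
  rw [div_le_iff₀ (Finset.sum_pos (fun j _ => hd j) Finset.univ_nonempty)]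
  calc m = ∑ j, d j * (m * gaussianRatio d j j) := by
        simp_rw [mul_left_comm _ m]
        rw [← Finset.mul_sum, sum_mul_gaussianRatio hm hmd, mul_one]
    _ ≤ ∑ j, d j * (d i * gaussianRatio d i i) :=
        Finset.sum_le_sum fun j _ => mul_le_mul_of_nonneg_left (key j) (hd j).le
    _ = _ := by rw [← Finset.sum_mul, mul_comm]

theorem le_integral_sq_div_diagonal [Nonempty ι] (hm : 0 < m) (hmd : ∀ i, m ≤ d i)
    (y : ι → ℝ) :
    m / (∑ j, d j) * ∑ i, d i * y i ^ 2 ≤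
      ∫ v : ι → ℝ, (∑ i, d i * (v i * y i)) ^ 2 / ∑ k, d k * v k ^ 2
        ∂(Measure.pi fun _ => gaussianReal 0 1) := by
  have hd : ∀ i, 0 < d i := fun i => hm.trans_le (hmd i)
  have hexp : ∀ v : ι → ℝ, (∑ i, d i * (v i * y i)) ^ 2 / ∑ k, d k * v k ^ 2 =
      ∑ i, ∑ j, d i * y i * (d j * y j) * (v i * v j / ∑ k, d k * v k ^ 2) := by
    intro v
    rw [sq, Finset.sum_mul_sum, Finset.sum_div]
    refine Finset.sum_congr rfl fun i _ => ?_
    rw [Finset.sum_div]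
    refine Finset.sum_congr rfl fun j _ => ?_
    ring
  have hint : ∀ i j, Integrable
      (fun v : ι → ℝ => d i * y i * (d j * y j) * (v i * v j / ∑ k, d k * v k ^ 2))
      (Measure.pi fun _ => gaussianReal 0 1) := fun i j =>
    (integrable_mul_div_sum _ hm hmd i j).const_mul _
  have hlow := le_mul_gaussianRatio hm hmd
  generalize ∑ j, d j = D at hlow ⊢
  simp_rw [hexp]
  rw [integral_finsetSum _ fun i _ => integrable_finsetSum _ fun j _ => hint i j, Finset.mul_sum]
  refine Finset.sum_le_sum fun i _ => ?_
  rw [integral_finsetSum _ fun j _ => hint i j, Finset.sum_eq_single_of_mem i (Finset.mem_univ i)]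
  · rw [integral_const_mul]
    change _ ≤ _ * gaussianRatio d i i
    nlinarith [mul_le_mul_of_nonneg_right (hlow i)
      (mul_nonneg (hd i).le (sq_nonneg (y i)))]
  · intro j _ hji
    rw [integral_const_mul]
    exact mul_eq_zero_of_right _ (gaussianRatio_eq_zero d hji.symm)

end Diagonal

lemma quadratic_lineSearch {ι : Type*} [Fintype ι] {A : Matrix ι ι ℝ} (hA : A.IsHermitian)
    (x u : ι → ℝ) :
    (x - ((u ⬝ᵥ A *ᵥ x) / (u ⬝ᵥ A *ᵥ u)) • u) ⬝ᵥ
        A *ᵥ (x - ((u ⬝ᵥ A *ᵥ x) / (u ⬝ᵥ A *ᵥ u)) • u) =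
      x ⬝ᵥ A *ᵥ x - (u ⬝ᵥ A *ᵥ x) ^ 2 / (u ⬝ᵥ A *ᵥ u) := by
  have hsymm : x ⬝ᵥ A *ᵥ u = u ⬝ᵥ A *ᵥ x := by
    have hT : Aᵀ = A := by simpa using hA.eq
    rw [dotProduct_mulVec, ← mulVec_transpose, hT, dotProduct_comm]
  simp only [mulVec_sub, mulVec_smul, dotProduct_sub, sub_dotProduct, smul_dotProduct,
    dotProduct_smul, hsymm, smul_eq_mul]
  by_cases h : u ⬝ᵥ A *ᵥ u = 0
  · simp [h]
  · field_simp
    ring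

section Quadratic

variable {ι : Type*} [Fintype ι] [DecidableEq ι] {A : Matrix ι ι ℝ}

lemma dotProduct_mulVec_eigenvectorBasis_sum (hA : A.IsHermitian) (v y : ι → ℝ) :
    WithLp.ofLp (∑ i, v i • hA.eigenvectorBasis i) ⬝ᵥ
        A *ᵥ WithLp.ofLp (∑ i, y i • hA.eigenvectorBasis i) =
      ∑ i, hA.eigenvalues i * (v i * y i) := by
  have horth : ∀ i j, WithLp.ofLp (hA.eigenvectorBasis i) ⬝ᵥ
      WithLp.ofLp (hA.eigenvectorBasis j) = if i = j then 1 else 0 := by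
    intro i j
    have := orthonormal_iff_ite.1 hA.eigenvectorBasis.orthonormal j i
    rw [EuclideanSpace.inner_eq_star_dotProduct] at this
    simpa [eq_comm] using this
  simp only [WithLp.ofLp_sum, WithLp.ofLp_smul, Matrix.mulVec_sum, Matrix.mulVec_smul,
    hA.mulVec_eigenvectorBasis, sum_dotProduct, dotProduct_sum, smul_dotProduct, dotProduct_smul,
    horth, smul_eq_mul]
  refine Finset.sum_congr rfl fun i _ => ?_
  simp
  ring

theorem le_integral_sq_div_quadratic [Nonempty ι] (hA : A.IsHermitian) {m : ℝ} (hm : 0 < m)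
    (hmd : ∀ i, m ≤ hA.eigenvalues i) (x : ι → ℝ) :
    m / A.trace * (x ⬝ᵥ A *ᵥ x) ≤
      ∫ u : ι → ℝ, (u ⬝ᵥ A *ᵥ x) ^ 2 / (u ⬝ᵥ A *ᵥ u)
        ∂(Measure.pi fun _ => gaussianReal 0 1) := by
  obtain ⟨y, rfl⟩ : ∃ y : ι → ℝ, WithLp.ofLp (∑ i, y i • hA.eigenvectorBasis i) = x :=
    ⟨fun i => hA.eigenvectorBasis.repr (WithLp.toLp 2 x) i, by
      rw [hA.eigenvectorBasis.sum_repr]⟩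
  have hmp := measurePreserving_gaussian_orthonormalBasis hA.eigenvectorBasis
  conv_rhs => rw [← hmp.map_eq]
  rw [integral_map hmp.aemeasurable (Measurable.aestronglyMeasurable (by
    simp only [dotProduct, mulVec]; fun_prop))]
  simp only [dotProduct_mulVec_eigenvectorBasis_sum, hA.trace_eq_sum_eigenvalues, ← sq]
  exact le_integral_sq_div_diagonal hm hmd y

end Quadratic

/-- Linear convergence of Random Pursuit with exact line search on the quadratic
`f(x) = (1/2)⟨x, A x⟩`: starting from `x₀` and performing `N` exact line-search
steps along independent standard Gaussian directions `u₁, …, u_N`, the expected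
function value satisfies
`E[f(x_N)] ≤ (1 − λ_min(A)/Tr(A))^N f(x₀)`,
where the expectation is over the `N`-fold product of the standard Gaussian
measure `μ` on `ℝⁿ`. The step map `T` performs exact line search:
`T(x, u) = x − (⟨u, A x⟩/⟨u, A u⟩) u` if `⟨u, A u⟩ ≠ 0`, and `T(x, u) = x`
otherwise. -/
theorem random_pursuit_linear_convergence
    (n N : ℕ) (hn : 1 ≤ n) (hN : 1 ≤ N)
    (μ : Measure (Fin n → ℝ))
    (hμ : μ = Measure.pi fun _ : Fin n => gaussianReal 0 1)
    (A : Matrix (Fin n) (Fin n) ℝ)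
    (hA : A.IsHermitian)
    (hpos : ∀ v : Fin n → ℝ, v ≠ 0 → 0 < v ⬝ᵥ A *ᵥ v)
    (f : (Fin n → ℝ) → ℝ)
    (hf : ∀ x : Fin n → ℝ, f x = (1 / 2) * (x ⬝ᵥ A *ᵥ x))
    (T : (Fin n → ℝ) → (Fin n → ℝ) → (Fin n → ℝ))
    (hT : ∀ x u : Fin n → ℝ,
      (u ⬝ᵥ A *ᵥ u ≠ 0 → T x u = x - ((u ⬝ᵥ A *ᵥ x) / (u ⬝ᵥ A *ᵥ u)) • u) ∧
      (u ⬝ᵥ A *ᵥ u = 0 → T x u = x))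
    (x₀ : Fin n → ℝ)
    (X : (Fin N → (Fin n → ℝ)) → ℕ → (Fin n → ℝ))
    (hX0 : ∀ U : Fin N → (Fin n → ℝ), X U 0 = x₀)
    (hXsucc : ∀ (U : Fin N → (Fin n → ℝ)) (k : Fin N),
      X U ((k : ℕ) + 1) = T (X U (k : ℕ)) (U k)) :
    ∫ U, f (X U N) ∂(Measure.pi fun _ : Fin N => μ)
      ≤ (1 - (⨅ i, hA.eigenvalues i) / A.trace) ^ N * f x₀ := by
  subst hμ
  have : Nonempty (Fin n) := ⟨⟨0, hn⟩⟩
  have hTeq : ∀ x u, T x u = x - ((u ⬝ᵥ A *ᵥ x) / (u ⬝ᵥ A *ᵥ u)) • u := by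
    intro x u
    by_cases h : u ⬝ᵥ A *ᵥ u = 0
    · rw [(hT x u).2 h]
      simp [h]
    · exact (hT x u).1 h
  have hnonneg : ∀ v : Fin n → ℝ, 0 ≤ v ⬝ᵥ A *ᵥ v := fun v => by
    by_cases hv : v = 0
    · simp [hv]
    · exact (hpos v hv).le
  have heig : ∀ i, 0 < hA.eigenvalues i := fun i => by
    rw [hA.eigenvalues_eq]
    refine hpos _ fun h => hA.eigenvectorBasis.orthonormal.ne_zero i ?_
    ext k
    exact congrFun h k
  obtain ⟨i₀, hi₀⟩ := exists_eq_ciInf_of_finite (f := hA.eigenvalues)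
  have hm : 0 < ⨅ i, hA.eigenvalues i := hi₀ ▸ heig i₀
  have hmd : ∀ i, ⨅ j, hA.eigenvalues j ≤ hA.eigenvalues i :=
    fun i => ciInf_le (Set.finite_range _).bddBelow i
  have htr : A.trace = ∑ i, hA.eigenvalues i := by simpa using hA.trace_eq_sum_eigenvalues
  have htrpos : 0 < A.trace := htr ▸ Finset.sum_pos (fun i _ => heig i) Finset.univ_nonempty
  have hc : 0 ≤ 1 - (⨅ i, hA.eigenvalues i) / A.trace := by
    rw [sub_nonneg, div_le_one htrpos, ← hi₀, htr]
    exact Finset.single_le_sum (fun i _ => (heig i).le) (Finset.mem_univ i₀)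
  have hfT : ∀ x u, f (T x u) = f x - 1 / 2 * ((u ⬝ᵥ A *ᵥ x) ^ 2 / (u ⬝ᵥ A *ᵥ u)) := by
    intro x u
    rw [hf, hf, hTeq, quadratic_lineSearch hA]
    ring
  have hf0 : ∀ x, 0 ≤ f x := fun x => by
    rw [hf]
    exact mul_nonneg (by norm_num) (hnonneg x)
  have hdec0 : ∀ x u : Fin n → ℝ, 0 ≤ (u ⬝ᵥ A *ᵥ x) ^ 2 / (u ⬝ᵥ A *ᵥ u) :=
    fun x u => div_nonneg (sq_nonneg _) (hnonneg u)
  have hle : ∀ x u, f (T x u) ≤ f x := fun x u => by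
    rw [hfT]
    linarith [hdec0 x u]
  have hfm : Measurable f := by
    rw [funext hf]
    simp only [dotProduct, mulVec]
    fun_prop
  have hTm : Measurable fun p : (Fin n → ℝ) × (Fin n → ℝ) => T p.1 p.2 := by
    simp only [hTeq, dotProduct, mulVec]
    fun_prop
  simp_rw [fun U => eq_drivenIterate T x₀ U (X U) (hX0 U) (hXsucc U)]
  refine integral_drivenIterate_le _ hTm hfm hf0 hle hc (fun x => ?_) x₀ N
  have hint : Integrable (fun u : Fin n → ℝ => (u ⬝ᵥ A *ᵥ x) ^ 2 / (u ⬝ᵥ A *ᵥ u))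
      (Measure.pi fun _ => gaussianReal 0 1) := by
    refine Integrable.of_bound (Measurable.aestronglyMeasurable (by
      simp only [dotProduct, mulVec]; fun_prop)) (2 * f x) (ae_of_all _ fun u => ?_)
    rw [Real.norm_of_nonneg (hdec0 x u)]
    linarith [hfT x u, hf0 (T x u)]
  simp_rw [hfT]
  rw [integral_sub (integrable_const _) (hint.const_mul _), integral_const_mul]
  have hkey := le_integral_sq_div_quadratic hA hm hmd x
  simp only [integral_const, probReal_univ, one_smul]
  rw [hf x]
  linarith
end
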